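/- arXiv:2408.04952 — 2 statements merged into one kernel-verified Lean document; each statement's English description precedes it below -/
import Mathlib

section
/- For a connected simple graph with n_V vertices, the adjugate of the graph Laplacian Δ equals κ times the all-ones matrix, where κ is the number of spanning trees of G. -/
open Matrix

namespace MTT

variable {V : Type*}

theorem exists_depth {r : V} {f : V → V} (h : ∀ v, ∃ k : ℕ, f^[k] v = r) :
    ∃ d : V → ℕ, ∀ v, v ≠ r → d (f v) < d v := by
  classical
  refine ⟨fun v => Nat.find (h v), fun v hv => ?_⟩
  have h1 := Nat.find_spec (h v)
  rcases hk : Nat.find (h v) with _ | k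
  · rw [hk] at h1
    exact absurd h1 hv
  · rw [hk, Function.iterate_succ_apply] at h1
    have := Nat.find_min' (h (f v)) h1
    show Nat.find (h (f v)) < Nat.find (h v)
    omega

theorem depth_ind {r : V} {f : V → V} {d : V → ℕ} (hd : ∀ v, v ≠ r → d (f v) < d v)
    (P : V → Prop) (hr : P r) (hs : ∀ v, v ≠ r → P (f v) → P v) (v : V) : P v := by
  induction hn : d v using Nat.strong_induction_on generalizing v with
  | _ n ih =>
    by_cases hv : v = r
    · exact hv ▸ hr
    · exact hs v hv (ih _ (hn ▸ hd v hv) _ rfl)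

theorem iterate_of_depth {r : V} {f : V → V} {d : V → ℕ} (hd : ∀ v, v ≠ r → d (f v) < d v)
    (v : V) : ∃ k : ℕ, f^[k] v = r :=
  depth_ind hd (fun v => ∃ k : ℕ, f^[k] v = r) ⟨0, rfl⟩
    (fun _ _ ⟨k, hk⟩ => ⟨k + 1, hk⟩) v

/-- the row of index `v` for the choice `w` -/
def row [DecidableEq V] (r v w : V) : V → ℝ :=
  if v = r then Pi.single r 1 else Pi.single v 1 - Pi.single w 1

theorem det_good [Fintype V] [DecidableEq V] {r : V} {f : V → V}
    (h : ∀ v, ∃ k : ℕ, f^[k] v = r) :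
    (Matrix.of (fun v => row r v (f v))).det = 1 := by
  obtain ⟨d, hd⟩ := exists_depth h
  have hM : ∀ i j, d i ≤ d j → (Matrix.of (fun v => row r v (f v))) i j = (1 : Matrix V V ℝ) i j := by
    intro i j hij
    simp only [Matrix.of_apply, row, Matrix.one_apply]
    split_ifs with h1 h2 h2
    · subst h1; subst h2; simp
    · subst h1; simp [Pi.single_apply, Ne.symm h2]
    · subst h2
      have : f i ≠ i := fun e => by have := hd i h1; rw [e] at this; omega
      simp [Pi.single_apply, this.symm]
    · have : j ≠ f i := fun e => by have := hd i h1; rw [← e] at this; omega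
      simp [Pi.single_apply, this, Ne.symm h2]
  have hB : BlockTriangular (Matrix.of (fun v => row r v (f v))) (fun v => OrderDual.toDual (d v)) := by
    intro i j hij
    have hij' : d i < d j := hij
    rw [hM i j hij'.le, Matrix.one_apply_ne]
    rintro rfl
    exact lt_irrefl _ hij'
  rw [hB.det]
  refine Finset.prod_eq_one fun a _ => ?_
  have : (Matrix.of (fun v => row r v (f v))).toSquareBlock (fun v => OrderDual.toDual (d v)) a = 1 := by
    ext ⟨i, hi⟩ ⟨j, hj⟩
    have hij : d i = d j := OrderDual.toDual.injective (hi.trans hj.symm)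
    simp only [Matrix.toSquareBlock_def, Matrix.of_apply]
    have := hM i j hij.le
    simp only [Matrix.of_apply] at this
    rw [this]
    simp [Matrix.one_apply]
  rw [this, det_one]

theorem det_bad [Fintype V] [DecidableEq V] {r : V} {f : V → V}
    (h : ¬ ∀ v, ∃ k : ℕ, f^[k] v = r) :
    (Matrix.of (fun v => row r v (f v))).det = 0 := by
  classical
  push Not at h
  obtain ⟨v, hv⟩ := h
  rw [← Matrix.exists_mulVec_eq_zero_iff]
  refine ⟨fun w => if ∃ k : ℕ, f^[k] w = r then 0 else 1, ?_, ?_⟩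
  · intro e
    have := congrFun e v
    simp [hv] at this
  · ext w
    simp only [Matrix.mulVec, Matrix.of_apply, row, Pi.zero_apply]
    split_ifs with hw
    · subst hw
      rw [single_one_dotProduct, if_pos ⟨0, rfl⟩]
    · rw [sub_dotProduct, single_one_dotProduct, single_one_dotProduct]
      have : (∃ k : ℕ, f^[k] w = r) ↔ (∃ k : ℕ, f^[k] (f w) = r) := by
        constructor
        · rintro ⟨_ | k, hk⟩
          · exact absurd hk hw
          · exact ⟨k, hk⟩
        · rintro ⟨k, hk⟩
          exact ⟨k + 1, hk⟩
      simp only [this, sub_self]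

/-- admissible parent functions -/
def Good (G : SimpleGraph V) (r : V) (f : V → V) : Prop :=
  (f r = r ∧ ∀ v, v ≠ r → G.Adj v (f v)) ∧ ∀ v, ∃ k : ℕ, f^[k] v = r

theorem adjugate_eq_card [Fintype V] [DecidableEq V] (G : SimpleGraph V) [DecidableRel G.Adj]
    (r : V) : (G.lapMatrix ℝ).adjugate r r = (Nat.card {f : V → V // Good G r f} : ℝ) := by
  classical
  rw [Matrix.adjugate_apply]
  let A : V → Finset V := fun v => if v = r then {r} else G.neighborFinset v
  have h1 : (G.lapMatrix ℝ).updateRow r (Pi.single r 1)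
      = Matrix.of (fun v => ∑ w ∈ A v, row r v w) := by
    ext v w
    simp only [Matrix.of_apply, A]
    by_cases hv : v = r
    · subst hv
      simp [row]
    · rw [Matrix.updateRow_ne hv]
      simp only [hv, if_false, row]
      rw [Finset.sum_sub_distrib]
      simp [SimpleGraph.lapMatrix, SimpleGraph.degMatrix, Matrix.diagonal_apply,
        SimpleGraph.adjMatrix_apply, Pi.single_apply, eq_comm]
  have h2 := (Matrix.detRowAlternating (n := V) (R := ℝ)).toMultilinearMap.map_sum_finset
    (fun v w => row r v w) A
  have h3 : (Matrix.of (fun v => ∑ w ∈ A v, row r v w)).det =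
      ∑ f ∈ Fintype.piFinset A, (Matrix.of (fun v => row r v (f v))).det := h2
  rw [h1, h3]
  have h4 : ∀ f : V → V, (Matrix.of (fun v => row r v (f v))).det =
      if ∀ v, ∃ k : ℕ, f^[k] v = r then 1 else 0 := by
    intro f
    split_ifs with h
    · exact det_good h
    · exact det_bad h
  simp only [h4]
  rw [Finset.sum_boole, Nat.subtype_card]
  intro f
  simp only [Finset.mem_filter, Fintype.mem_piFinset, Good, A]
  refine and_congr_left fun _ => ⟨fun h => ⟨by simpa using h r, fun v hv => by
    simpa [hv] using h v⟩, fun h v => ?_⟩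
  by_cases hv : v = r
  · subst hv; simpa using h.1
  · simpa [hv] using h.2 v hv

/-- the graph of a parent function -/
def T (f : V → V) : SimpleGraph V := SimpleGraph.fromRel (fun v w => f v = w)

theorem T_adj {f : V → V} {v w : V} : (T f).Adj v w ↔ v ≠ w ∧ (f v = w ∨ f w = v) := by
  simp [T]

theorem T_connected {r : V} {f : V → V} (h : ∀ v, ∃ k : ℕ, f^[k] v = r) : (T f).Connected := by
  obtain ⟨d, hd⟩ := exists_depth h
  rw [SimpleGraph.connected_iff_exists_forall_reachable]
  refine ⟨r, depth_ind hd _ (SimpleGraph.Reachable.refl _) fun v hv hr => hr.trans ?_⟩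
  refine SimpleGraph.Adj.reachable (T_adj.2 ⟨fun e => ?_, Or.inr rfl⟩)
  have := hd v hv
  rw [e] at this
  omega

theorem T_isTree [Finite V] {r : V} {f : V → V} (hr : f r = r) (h : ∀ v, ∃ k : ℕ, f^[k] v = r) :
    (T f).IsTree := by
  rw [SimpleGraph.isTree_iff_connected_and_card]
  refine ⟨T_connected h, ?_⟩
  have h1 := (T_connected h).card_vert_le_card_edgeSet_add_one
  have h2 : (T f).edgeSet ⊆ (fun v => s(v, f v)) '' {r}ᶜ := by
    intro e
    induction e with
    | _ v w =>
      rw [SimpleGraph.mem_edgeSet, T_adj]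
      rintro ⟨hne, e | e⟩
      · refine ⟨v, ?_, by simp [e]⟩
        rintro rfl
        exact hne (hr.symm.trans e)
      · refine ⟨w, ?_, by simp [e, Sym2.eq_swap]⟩
        rintro rfl
        exact hne (e.symm.trans hr)
  have h3 : (T f).edgeSet.ncard ≤ ({r}ᶜ : Set V).ncard :=
    (Set.ncard_le_ncard h2 (Set.toFinite _)).trans (Set.ncard_image_le (Set.toFinite _))
  have h4 := Set.ncard_add_ncard_compl ({r} : Set V)
  rw [Set.ncard_singleton] at h4
  rw [← Nat.card_coe_set_eq] at h3
  omega

theorem T_inj {r : V} {f g : V → V} (hf : f r = r) (hg : g r = r)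
    (h : ∀ v, ∃ k : ℕ, f^[k] v = r) (he : T f = T g) : f = g := by
  obtain ⟨d, hd⟩ := exists_depth h
  funext v
  refine depth_ind hd (fun v => f v = g v) (hf.trans hg.symm) (fun v hv hP => ?_) v
  have h1 := hd v hv
  have h0 : v ≠ f v := fun e => by rw [← e] at h1; omega
  have hadj : (T g).Adj v (f v) := he ▸ T_adj.2 ⟨h0, Or.inl rfl⟩
  rcases (T_adj.1 hadj).2 with h2 | h2
  · exact h2.symm
  · exfalso
    rw [h2] at hP
    by_cases h3 : f v = r
    · rw [h3, hf] at hP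
      exact hv hP.symm
    · have := hd _ h3
      rw [hP] at this
      omega

theorem T_le {G : SimpleGraph V} {r : V} {f : V → V} (hf : f r = r)
    (h : ∀ v, v ≠ r → G.Adj v (f v)) : T f ≤ G := by
  intro v w hvw
  obtain ⟨hne, e | e⟩ := T_adj.1 hvw
  · subst e
    exact h v fun e => hne (by rw [e, hf])
  · subst e
    exact (h w fun e => hne (by rw [e, hf])).symm

theorem T_surj {H : SimpleGraph V} (hH : H.IsTree) (r : V) : ∃ f, Good H r f ∧ T f = H := by
  classical
  have h1 : ∀ v, ∃ w, (v = r → w = r) ∧ (v ≠ r → H.Adj v w ∧ H.dist w r < H.dist v r) := by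
    intro v
    by_cases hv : v = r
    · exact ⟨r, fun _ => rfl, fun h => absurd hv h⟩
    · obtain ⟨p, hp⟩ := hH.connected.exists_walk_length_eq_dist v r
      cases p with
      | nil => exact absurd rfl hv
      | @cons _ w _ hadj q =>
        refine ⟨w, fun h => absurd h hv, fun _ => ⟨hadj, ?_⟩⟩
        have := H.dist_le q
        rw [SimpleGraph.Walk.length_cons] at hp
        omega
  choose f hf1 hf2 using h1
  have hd := iterate_of_depth (d := fun v => H.dist v r) fun v hv => (hf2 v hv).2
  have hle : T f ≤ H := T_le (hf1 r rfl) fun v hv => (hf2 v hv).1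
  refine ⟨f, ⟨⟨hf1 r rfl, fun v hv => (hf2 v hv).1⟩, hd⟩, le_antisymm hle ?_⟩
  exact (SimpleGraph.isTree_iff_minimal_connected.1 hH).2 (T_connected hd) hle

theorem card_eq [Finite V] (G : SimpleGraph V) (r : V) :
    Nat.card {f : V → V // Good G r f} =
      Nat.card {H : G.Subgraph // H.IsSpanning ∧ H.coe.IsTree} := by
  let F : {f : V → V // Good G r f} → {H : G.Subgraph // H.IsSpanning ∧ H.coe.IsTree} :=
    fun f => ⟨SimpleGraph.toSubgraph (T f.1) (T_le f.2.1.1 f.2.1.2),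
      SimpleGraph.toSubgraph.isSpanning _ _,
      (SimpleGraph.Subgraph.spanningCoeEquivCoeOfSpanning _
        (SimpleGraph.toSubgraph.isSpanning _ _)).isTree_iff.1 (T_isTree f.2.1.1 f.2.2)⟩
  refine Nat.card_congr (Equiv.ofBijective F ⟨?_, ?_⟩)
  · intro f g hfg
    apply Subtype.ext
    refine T_inj f.2.1.1 g.2.1.1 f.2.2 ?_
    have := congrArg (fun H => H.1.spanningCoe) hfg
    exact this
  · rintro ⟨H, hs, ht⟩
    rw [← (H.spanningCoeEquivCoeOfSpanning hs).isTree_iff] at ht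
    obtain ⟨f, hf, hT⟩ := T_surj ht r
    refine ⟨⟨f, ⟨hf.1.1, fun v hv => H.spanningCoe_le (hf.1.2 v hv)⟩, hf.2⟩, ?_⟩
    apply Subtype.ext
    apply SimpleGraph.Subgraph.ext
    · exact (SimpleGraph.Subgraph.isSpanning_iff.1 hs).symm
    · exact congrArg SimpleGraph.Adj hT

end MTT

/-- For a connected simple graph `G` on `n_V` vertices, the adjugate of the graph
Laplacian `Δ = D − A` equals `κ` times the all-ones matrix, where `κ` is the number of
spanning trees of `G`. -/
theorem adjugate_laplacian_eq_spanning_tree_count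
    {V : Type*} [Fintype V] [DecidableEq V]
    (G : SimpleGraph V) [DecidableRel G.Adj]
    (hconn : G.Connected)
    (Δ : Matrix V V ℝ)
    (hΔ : Δ = Matrix.diagonal (fun v => (G.degree v : ℝ)) - G.adjMatrix ℝ)
    (κ : ℕ)
    (hκ : κ = Nat.card {H : G.Subgraph // H.IsSpanning ∧ H.coe.IsTree}) :
    Δ.adjugate = (κ : ℝ) • Matrix.of (fun _ _ : V => (1 : ℝ)) := by
  have hL : Δ = G.lapMatrix ℝ := hΔ
  have : Nonempty V := hconn.nonempty
  have h0 : G.lapMatrix ℝ * (G.lapMatrix ℝ).adjugate = 0 := by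
    rw [Matrix.mul_adjugate, SimpleGraph.det_lapMatrix_eq_zero, zero_smul]
  have hcol : ∀ i j k, (G.lapMatrix ℝ).adjugate i k = (G.lapMatrix ℝ).adjugate j k := by
    intro i j k
    have : G.lapMatrix ℝ *ᵥ (fun i => (G.lapMatrix ℝ).adjugate i k) = 0 := by
      ext l
      exact congrFun (congrFun h0 l) k
    exact (G.lapMatrix_mulVec_eq_zero_iff_forall_reachable.1 this) i j (hconn i j)
  ext i j
  rw [hL, hcol i j j, MTT.adjugate_eq_card, MTT.card_eq, hκ]
  simp
end

section
/- The derivative of det Σ(q) at q = (1−u)^{-1} equals 2κ n_V (u − u_*) / (1−u)^{n_V−1}, where u_* = 1 − n_E/n_V and κ is the number of spanning trees. In particular, q = (1−u)^{-1} is a simple zero of det Σ(q) if and only if u ≠ u_*. -/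
open Matrix

lemma hasDerivAt_det_aux {V : Type*} [Fintype V] [DecidableEq V]
    (M : ℝ → Matrix V V ℝ) (M' : Matrix V V ℝ) (q : ℝ)
    (h : ∀ i j, HasDerivAt (fun t => M t i j) (M' i j) q) :
    HasDerivAt (fun t => (M t).det) (∑ i, ∑ j, (M q).adjugate i j * M' j i) q := by
  have h1 : HasDerivAt (fun t => (M t).det)
      (∑ σ : Equiv.Perm V, ((Equiv.Perm.sign σ : ℤ) : ℝ) *
        ∑ i, (∏ j ∈ Finset.univ.erase i, M q (σ j) j) • M' (σ i) i) q := by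
    simp only [Matrix.det_apply']
    refine HasDerivAt.fun_sum fun σ _ => HasDerivAt.const_mul _ ?_
    exact HasDerivAt.fun_finsetProd fun i _ => h (σ i) i
  suffices hE : (∑ i, ∑ j, (M q).adjugate i j * M' j i) =
      ∑ σ : Equiv.Perm V, ((Equiv.Perm.sign σ : ℤ) : ℝ) *
        ∑ i, (∏ j ∈ Finset.univ.erase i, M q (σ j) j) • M' (σ i) i by
    rw [hE]; exact h1
  simp only [Finset.mul_sum]
  refine Eq.trans ?_ Finset.sum_comm
  refine Finset.sum_congr rfl fun i _ => ?_
  have h2 : ∑ j, (M q).adjugate i j * M' j i = ((M q).updateCol i (fun j => M' j i)).det := by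
    rw [← Matrix.cramer_apply, Matrix.cramer_eq_adjugate_mulVec]
    rfl
  rw [h2, Matrix.det_apply']
  refine Finset.sum_congr rfl fun σ _ => ?_
  congr 1
  rw [← Finset.prod_erase_mul _ _ (Finset.mem_univ i)]
  simp only [Matrix.updateCol_self, smul_eq_mul]
  congr 1
  refine Finset.prod_congr rfl fun j hj => ?_
  rw [Matrix.updateCol_ne (Finset.ne_of_mem_erase hj)]

/-- Parent functions directed to the root. -/
def GoodFn {V : Type*} (G : SimpleGraph V) (r : V) (φ : V → V) : Prop :=
  φ r = r ∧ (∀ v, v ≠ r → G.Adj v (φ v)) ∧ ∃ h : V → ℕ, ∀ v, v ≠ r → h (φ v) < h v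

lemma det_fn_of_height {V : Type*} [Fintype V] [DecidableEq V] (r : V) (φ : V → V)
    (h : V → ℕ) (hh : ∀ v, v ≠ r → h (φ v) < h v) :
    (Matrix.of fun v => if v = r then Pi.single r (1 : ℝ)
      else Pi.single v 1 - Pi.single (φ v) 1).det = 1 := by
  set M : Matrix V V ℝ := Matrix.of fun v => if v = r then Pi.single r (1 : ℝ)
      else Pi.single v 1 - Pi.single (φ v) 1 with hM
  have key : ∀ v w, v ≠ w → M v w ≠ 0 → h w < h v := by
    intro v w hvw hne
    by_cases hv : v = r
    · subst hv; simp [hM, Pi.single_apply, hvw.symm] at hne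
    · by_cases hw : w = φ v
      · subst hw; exact hh v hv
      · simp [hM, hv, Pi.single_apply, hvw.symm, hw] at hne
  have diag : ∀ v, M v v = 1 := by
    intro v
    by_cases hv : v = r
    · subst hv; simp [hM]
    · have : v ≠ φ v := fun e => by have := hh v hv; rw [← e] at this; omega
      simp [hM, hv, Pi.single_apply, this]
  have hB : M.BlockTriangular (fun v => OrderDual.toDual (h v)) := by
    intro i j hij
    by_contra hne
    have hij' : h i < h j := hij
    have := key i j (by rintro rfl; omega) hne
    omega
  rw [hB.det]
  refine Finset.prod_eq_one fun a _ => ?_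
  have : M.toSquareBlock (fun v => OrderDual.toDual (h v)) a = 1 := by
    ext ⟨i, hi⟩ ⟨j, hj⟩
    by_cases hij : i = j
    · subst hij; simp [Matrix.toSquareBlock_def, diag]
    · have hz : M i j = 0 := by
        by_contra hne
        have := key i j hij hne
        have e : h i = h j := OrderDual.toDual.injective (hi.trans hj.symm)
        omega
      simp [Matrix.toSquareBlock_def, hz, Matrix.one_apply, hij]
  rw [this, Matrix.det_one]

lemma det_fn_of_bad {V : Type*} [Fintype V] [DecidableEq V] (r : V) (φ : V → V)
    (hr : φ r = r) (hbad : ¬ ∃ h : V → ℕ, ∀ v, v ≠ r → h (φ v) < h v) :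
    (Matrix.of fun v => if v = r then Pi.single r (1 : ℝ)
      else Pi.single v 1 - Pi.single (φ v) 1).det = 0 := by
  classical
  have h1 : ∃ v, ∀ k, φ^[k] v ≠ r := by
    by_contra hcon
    push Not at hcon
    apply hbad
    refine ⟨fun v => Nat.find (hcon v), fun v hv => ?_⟩
    have hs := Nat.find_spec (hcon v)
    have hpos : Nat.find (hcon v) ≠ 0 := fun e => by
      rw [e] at hs; exact hv hs
    obtain ⟨m, hm⟩ := Nat.exists_eq_succ_of_ne_zero hpos
    rw [hm] at hs
    have : Nat.find (hcon (φ v)) ≤ m := Nat.find_min' _ (by simpa using hs)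
    show Nat.find (hcon (φ v)) < Nat.find (hcon v)
    omega
  obtain ⟨v0, hv0⟩ := h1
  rw [← Matrix.exists_mulVec_eq_zero_iff]
  refine ⟨fun v => if ∀ k, φ^[k] v ≠ r then 1 else 0, ?_, ?_⟩
  · intro e
    have := congrFun e v0
    simp only [Pi.zero_apply] at this
    rw [if_pos hv0] at this
    exact one_ne_zero this
  · ext v
    by_cases hv : v = r
    · subst hv
      simp only [Matrix.mulVec, Matrix.of_apply, if_true, single_dotProduct, Pi.zero_apply, one_mul]
      rw [if_neg]
      intro h; exact h 0 rfl
    · simp only [Matrix.mulVec, Matrix.of_apply, if_neg hv, sub_dotProduct, single_dotProduct,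
        Pi.zero_apply, one_mul]
      have : (∀ k, φ^[k] v ≠ r) ↔ ∀ k, φ^[k] (φ v) ≠ r := by
        constructor
        · intro h k; exact h (k+1)
        · intro h k
          cases k with
          | zero => exact hv
          | succ k => exact h k
      simp only [this, sub_self]

lemma adjugate_lap_diag {V : Type*} [Fintype V] [DecidableEq V]
    (G : SimpleGraph V) [DecidableRel G.Adj] (r : V) :
    (G.lapMatrix ℝ).adjugate r r = Nat.card {φ : V → V // GoodFn G r φ} := by
  classical
  rw [Matrix.adjugate_apply]
  have h1 : (G.lapMatrix ℝ).updateRow r (Pi.single r 1) = Matrix.of fun v =>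
      ∑ w ∈ (if v = r then {r} else G.neighborFinset v),
        (if v = r then Pi.single r (1 : ℝ) else Pi.single v 1 - Pi.single w 1) := by
    ext v w
    by_cases hv : v = r
    · subst hv; simp
    · rw [Matrix.updateRow_ne hv]
      simp only [hv, if_false, Matrix.of_apply, Finset.sum_apply, Pi.sub_apply,
        Finset.sum_sub_distrib, Finset.sum_const, Pi.single_apply, SimpleGraph.lapMatrix,
        SimpleGraph.degMatrix, Matrix.sub_apply, Matrix.diagonal_apply,
        SimpleGraph.adjMatrix_apply, Finset.sum_ite_eq, SimpleGraph.mem_neighborFinset,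
        SimpleGraph.card_neighborFinset_eq_degree, nsmul_eq_mul, mul_ite, mul_one, mul_zero,
        @eq_comm _ v w]
  rw [h1]
  have h2 := (Matrix.detRowAlternating (n := V) (R := ℝ)).toMultilinearMap.map_sum_finset
    (fun v w => (if v = r then Pi.single r (1 : ℝ) else Pi.single v 1 - Pi.single w 1 : V → ℝ))
    (fun v => (if v = r then {r} else G.neighborFinset v))
  refine Eq.trans h2 ?_
  have h3 : ∀ φ ∈ Fintype.piFinset (fun v => (if v = r then {r} else G.neighborFinset v)),
      (Matrix.detRowAlternating (n := V) (R := ℝ)).toMultilinearMap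
        (fun v => (if v = r then Pi.single r (1 : ℝ) else Pi.single v 1 - Pi.single (φ v) 1 : V → ℝ))
      = if GoodFn G r φ then 1 else 0 := by
    intro φ hφ
    rw [Fintype.mem_piFinset] at hφ
    have hr : φ r = r := by simpa using hφ r
    have ha : ∀ v, v ≠ r → G.Adj v (φ v) := fun v hv => by simpa [hv] using hφ v
    split_ifs with hg
    · obtain ⟨-, -, h, hh⟩ := hg
      exact det_fn_of_height r φ h hh
    · exact det_fn_of_bad r φ hr fun hex => hg ⟨hr, ha, hex⟩
  rw [Finset.sum_congr rfl h3, Finset.sum_boole, Nat.card_eq_fintype_card, Fintype.card_subtype]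
  congr 2
  ext φ
  simp only [Finset.mem_filter, Fintype.mem_piFinset, Finset.mem_univ, true_and, and_iff_right_iff_imp]
  rintro ⟨hr, ha, -⟩ v
  by_cases hv : v = r
  · subst hv; simp [hr]
  · simpa [hv] using ha v hv

/-- Graph of a parent function. -/
def fnGraph {V : Type*} (φ : V → V) : SimpleGraph V :=
  SimpleGraph.fromRel fun a b => φ a = b

lemma fnGraph_le {V : Type*} {G : SimpleGraph V} {r : V} {φ : V → V}
    (hr : φ r = r) (ha : ∀ v, v ≠ r → G.Adj v (φ v)) : fnGraph φ ≤ G := by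
  intro a b hab
  obtain ⟨hne, h | h⟩ := hab
  · subst h
    exact ha a fun e => hne (by rw [e, hr])
  · subst h
    exact (ha b fun e => hne (by rw [e, hr])).symm

lemma fnGraph_isTree {V : Type*} [Fintype V] {r : V} {φ : V → V}
    (hr : φ r = r) (h : V → ℕ) (hh : ∀ v, v ≠ r → h (φ v) < h v) : (fnGraph φ).IsTree := by
  classical
  have hreach : ∀ n v, h v = n → (fnGraph φ).Reachable v r := by
    intro n
    induction n using Nat.strong_induction_on with
    | _ n ih =>
      intro v hn
      by_cases hv : v = r
      · subst hv; exact SimpleGraph.Reachable.refl _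
      · have hlt := hh v hv
        refine SimpleGraph.Reachable.trans (SimpleGraph.Adj.reachable ?_)
          (ih _ (hn ▸ hlt) (φ v) rfl)
        refine ⟨?_, Or.inl rfl⟩
        intro e; rw [← e] at hlt; omega
  have hc : (fnGraph φ).Connected :=
    { preconnected := fun a b => (hreach _ a rfl).trans (hreach _ b rfl).symm
      nonempty := ⟨r⟩ }
  rw [SimpleGraph.isTree_iff_connected_and_card]
  refine ⟨hc, ?_⟩
  have h1 := hc.card_vert_le_card_edgeSet_add_one
  have h2 : (fnGraph φ).edgeSet ⊆ ((Finset.univ.erase r).image fun v => s(v, φ v) : Finset (Sym2 V)) := by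
    intro e
    induction e using Sym2.ind with
    | _ a b =>
      rintro ⟨hne, hab | hab⟩
      · have hab : φ a = b := hab
        subst hab
        simp only [Finset.coe_image, Set.mem_image, Finset.mem_coe, Finset.mem_erase, Finset.mem_univ, and_true]
        exact ⟨a, fun e => hne (by rw [e, hr]), rfl⟩
      · have hab : φ b = a := hab
        subst hab
        simp only [Finset.coe_image, Set.mem_image, Finset.mem_coe, Finset.mem_erase, Finset.mem_univ, and_true]
        exact ⟨b, fun e => hne (by rw [e, hr]), Sym2.eq_swap⟩
  have h3 : Nat.card (fnGraph φ).edgeSet ≤ Fintype.card V - 1 := by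
    rw [Nat.card_coe_set_eq]
    refine (Set.ncard_le_ncard h2 (Finset.finite_toSet _)).trans ?_
    rw [Set.ncard_coe_finset]
    refine Finset.card_image_le.trans ?_
    rw [Finset.card_erase_of_mem (Finset.mem_univ _), Finset.card_univ]
  have hpos : 0 < Fintype.card V := Fintype.card_pos_iff.mpr ⟨r⟩
  have hcV : Nat.card V = Fintype.card V := Nat.card_eq_fintype_card
  omega

lemma card_goodFn {V : Type*} [Fintype V] (G : SimpleGraph V) (r : V) :
    Nat.card {φ : V → V // GoodFn G r φ} = Nat.card {T : SimpleGraph V // T ≤ G ∧ T.IsTree} := by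
  classical
  refine Nat.card_congr (Equiv.ofBijective
    (fun φ => ⟨fnGraph φ.1, fnGraph_le φ.2.1 φ.2.2.1, by
      obtain ⟨h, hh⟩ := φ.2.2.2
      exact fnGraph_isTree φ.2.1 h hh⟩) ⟨?_, ?_⟩)
  · rintro ⟨φ, hr, ha, h, hh⟩ ⟨ψ, hr', ha', hx⟩ heq
    have heq : fnGraph φ = fnGraph ψ := congrArg Subtype.val heq
    have key : ∀ n v, h v = n → φ v = ψ v := by
      intro n
      induction n using Nat.strong_induction_on with
      | _ n ih =>
        intro v hn
        by_cases hv : v = r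
        · subst hv; rw [hr, hr']
        · have hlt := hh v hv
          have hadj : (fnGraph φ).Adj v (φ v) :=
            ⟨fun e => by rw [← e] at hlt; omega, Or.inl rfl⟩
          rw [heq] at hadj
          obtain ⟨-, h1 | h1⟩ := hadj
          · exact h1.symm
          · have h2 := ih _ (hn ▸ hlt) (φ v) rfl
            by_cases hw : φ v = r
            · rw [hw, hr'] at h1; exact absurd h1.symm hv
            · have := hh _ hw
              rw [h2, h1] at this
              omega
    exact Subtype.ext (funext fun v => key _ v rfl)
  · rintro ⟨T, hTG, hT⟩
    have hex : ∀ v, ∃ w, (v = r → w = r) ∧ (v ≠ r → T.Adj v w ∧ T.dist w r < T.dist v r) := by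
      intro v
      by_cases hv : v = r
      · exact ⟨r, fun _ => rfl, fun h => absurd hv h⟩
      · obtain ⟨p, hp⟩ := hT.1.exists_walk_length_eq_dist v r
        cases p with
        | nil => exact absurd rfl hv
        | @cons _ w _ hadj p =>
          refine ⟨w, fun h => absurd h hv, fun _ => ⟨hadj, ?_⟩⟩
          have := SimpleGraph.dist_le p
          rw [SimpleGraph.Walk.length_cons] at hp
          omega
    choose φ hφr hφ using hex
    have hle : fnGraph φ ≤ T := fnGraph_le (hφr r rfl) fun v hv => (hφ v hv).1
    refine ⟨⟨φ, hφr r rfl, fun v hv => hTG (hφ v hv).1, fun v => T.dist v r,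
      fun v hv => (hφ v hv).2⟩, Subtype.ext ?_⟩
    have ht := fnGraph_isTree (hφr r rfl) (fun v => T.dist v r) fun v hv => (hφ v hv).2
    exact le_antisymm hle ((SimpleGraph.isTree_iff_minimal_connected.mp hT).2 ht.1 hle)

lemma card_spanning {V : Type*} (G : SimpleGraph V) :
    Nat.card {H : G.Subgraph // H.IsSpanning ∧ H.coe.IsTree} =
      Nat.card {T : SimpleGraph V // T ≤ G ∧ T.IsTree} := by
  refine Nat.card_congr (Equiv.ofBijective
    (fun H => ⟨H.1.spanningCoe, H.1.spanningCoe_le,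
      (H.1.spanningCoeEquivCoeOfSpanning H.2.1).isTree_iff.mpr H.2.2⟩) ⟨?_, ?_⟩)
  · rintro ⟨H, hs, ht⟩ ⟨H', hs', ht'⟩ heq
    have heq : H.spanningCoe = H'.spanningCoe := congrArg Subtype.val heq
    refine Subtype.ext (SimpleGraph.Subgraph.ext ?_ ?_)
    · rw [SimpleGraph.Subgraph.isSpanning_iff.mp hs, SimpleGraph.Subgraph.isSpanning_iff.mp hs']
    · exact congrArg SimpleGraph.Adj heq
  · rintro ⟨T, hle, hT⟩
    have hs := SimpleGraph.toSubgraph.isSpanning T hle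
    refine ⟨⟨SimpleGraph.toSubgraph T hle, hs, ?_⟩, Subtype.ext ?_⟩
    · refine ((SimpleGraph.toSubgraph T hle).spanningCoeEquivCoeOfSpanning hs).isTree_iff.mp ?_
      exact hT
    · rfl

lemma adjugate_lap {V : Type*} [Fintype V] [DecidableEq V]
    (G : SimpleGraph V) [DecidableRel G.Adj] (hconn : G.Connected) (i j : V) :
    (G.lapMatrix ℝ).adjugate i j =
      Nat.card {H : G.Subgraph // H.IsSpanning ∧ H.coe.IsTree} := by
  have := hconn.nonempty
  rw [card_spanning, ← card_goodFn G j, ← adjugate_lap_diag]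
  have h := Matrix.mul_adjugate (G.lapMatrix ℝ)
  rw [SimpleGraph.det_lapMatrix_eq_zero, zero_smul] at h
  have h2 : G.lapMatrix ℝ *ᵥ (fun k => (G.lapMatrix ℝ).adjugate k j) = 0 := by
    ext k
    exact congrFun (congrFun h k) j
  exact (SimpleGraph.lapMatrix_mulVec_eq_zero_iff_forall_reachable G).mp h2 i j (hconn i j)

theorem deriv_det_sigma_at_one_sub_u_inv
    {V : Type*} [Fintype V] [DecidableEq V]
    (G : SimpleGraph V) [DecidableRel G.Adj]
    (hconn : G.Connected)
    (u : ℝ) (hu : u ≠ 1)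
    (A D Qu : Matrix V V ℝ)
    (hA : A = G.adjMatrix ℝ)
    (hD : D = Matrix.diagonal fun v => (G.degree v : ℝ))
    (hQ : Qu = (1 - u) • (D - (1 - u) • (1 : Matrix V V ℝ)))
    (κ : ℕ)
    (hκ : κ = Nat.card {H : G.Subgraph // H.IsSpanning ∧ H.coe.IsTree})
    (ustar : ℝ)
    (hustar : ustar = 1 - (G.edgeFinset.card : ℝ) / (Fintype.card V : ℝ))
    (f : ℝ → ℝ)
    (hf : ∀ q : ℝ, f q = ((1 : Matrix V V ℝ) - q • A + q ^ 2 • Qu).det) :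
    deriv f (1 - u)⁻¹ =
      2 * κ * (Fintype.card V : ℝ) * (u - ustar) / (1 - u) ^ (Fintype.card V - 1) ∧
    (deriv f (1 - u)⁻¹ ≠ 0 ↔ u ≠ ustar) := by
  have hs : (1 - u) ≠ 0 := sub_ne_zero.mpr hu.symm
  have := hconn.nonempty
  have hn : (Fintype.card V : ℝ) ≠ 0 := by exact_mod_cast Fintype.card_ne_zero
  have hκ0 : (κ : ℝ) ≠ 0 := by
    obtain ⟨T, hle, hT⟩ := hconn.exists_isTree_le
    rw [hκ, card_spanning]
    have : Nonempty {T : SimpleGraph V // T ≤ G ∧ T.IsTree} := ⟨⟨T, hle, hT⟩⟩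
    exact_mod_cast Nat.card_pos.ne'
  have main : deriv f (1 - u)⁻¹ =
      2 * κ * (Fintype.card V : ℝ) * (u - ustar) / (1 - u) ^ (Fintype.card V - 1) := by
    have hd := hasDerivAt_det_aux (fun q : ℝ => (1 : Matrix V V ℝ) - q • A + q ^ 2 • Qu)
      (-A + (2 * (1 - u)⁻¹) • Qu) (1 - u)⁻¹ (by
        intro i j
        simp only [Matrix.add_apply, Matrix.sub_apply, Matrix.smul_apply, smul_eq_mul,
          Matrix.neg_apply]
        have := (((hasDerivAt_id' (1 - u)⁻¹).mul_const (A i j)).const_sub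
          ((1 : Matrix V V ℝ) i j)).add ((hasDerivAt_pow 2 (1 - u)⁻¹).mul_const (Qu i j))
        refine HasDerivAt.congr_deriv this ?_
        simp)
    have hff : f = fun q : ℝ => ((1 : Matrix V V ℝ) - q • A + q ^ 2 • Qu).det := funext hf
    rw [hff, hd.deriv]
    have hS : (1 : Matrix V V ℝ) - (1 - u)⁻¹ • A + ((1 - u)⁻¹) ^ 2 • Qu
        = (1 - u)⁻¹ • G.lapMatrix ℝ := by
      ext i j
      simp only [hQ, hA, hD, SimpleGraph.lapMatrix, SimpleGraph.degMatrix, Matrix.add_apply,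
        Matrix.sub_apply, Matrix.smul_apply, smul_eq_mul]
      field_simp
      ring
    have hadj : ∀ i j, ((1 - u)⁻¹ • G.lapMatrix ℝ).adjugate i j
        = ((1 - u)⁻¹) ^ (Fintype.card V - 1) * κ := by
      intro i j
      rw [Matrix.adjugate_smul, Matrix.smul_apply, adjugate_lap G hconn, hκ, smul_eq_mul]
    simp only [hS, hadj]
    have hdeg : ∑ v, (G.degree v : ℝ) = 2 * G.edgeFinset.card := by
      exact_mod_cast G.sum_degrees_eq_twice_card_edges
    have hrow : ∀ i, ∑ j, (-A + (2 * (1 - u)⁻¹) • Qu) j i = G.degree i - 2 * (1 - u) := by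
      intro i
      have e : ∀ j, (-A + (2 * (1 - u)⁻¹) • Qu) j i
          = - (if G.Adj i j then 1 else 0) + if j = i then 2 * (G.degree i - (1 - u)) else 0 := by
        intro j
        simp only [hQ, hA, hD, Matrix.add_apply, Matrix.neg_apply, Matrix.sub_apply,
          Matrix.smul_apply, smul_eq_mul, SimpleGraph.adjMatrix_apply, Matrix.diagonal_apply,
          Matrix.one_apply, G.adj_comm j i]
        by_cases hji : j = i
        · subst hji; simp; field_simp
        · simp [hji]
      simp only [e, Finset.sum_add_distrib, Finset.sum_neg_distrib,
        ← SimpleGraph.degree_eq_sum_if_adj, Finset.sum_ite_eq', Finset.mem_univ, if_true]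
      ring
    simp only [← Finset.mul_sum, hrow, Finset.sum_sub_distrib, hdeg, Finset.sum_const,
      Finset.card_univ, nsmul_eq_mul, hustar]
    rw [inv_pow]
    field_simp
    ring
  refine ⟨main, ?_⟩
  rw [main]
  have hp : (1 - u) ^ (Fintype.card V - 1) ≠ 0 := pow_ne_zero _ hs
  rw [← sub_ne_zero (a := u)]
  constructor
  · intro h h0
    apply h
    rw [h0]; simp
  · intro h
    exact div_ne_zero (mul_ne_zero (mul_ne_zero (mul_ne_zero two_ne_zero hκ0) hn) h) hp
end
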